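/- For every complex number d with Re(d) > 0, there holds ₃F₂(1, 1, d+1; 5/2, d; 1/2) = 3π(1/d − 1/2) − 3(3/d − 2). -/

import Mathlib

open scoped Nat

/-- Pochhammer symbol `(x)_k = x (x+1) ⋯ (x+k-1)` for a complex number `x`. -/
noncomputable def poch (x : ℂ) (k : ℕ) : ℂ := (ascPochhammer ℂ k).eval x

/-- The generalized hypergeometric series
`ₚF_q(a₁,…,aₚ; b₁,…,b_q; z) = ∑ₖ ((a₁)ₖ ⋯ (aₚ)ₖ)/((b₁)ₖ ⋯ (b_q)ₖ) · zᵏ/k!`. -/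
noncomputable def hyp (a b : List ℂ) (z : ℂ) : ℂ :=
  ∑' k : ℕ, ((a.map (poch · k)).prod / (b.map (poch · k)).prod) * z ^ k / (k ! : ℂ)

theorem poch_succ (x : ℂ) (k : ℕ) : poch x (k + 1) = poch x k * (x + k) :=
  ascPochhammer_succ_eval k x

theorem poch_one (k : ℕ) : poch 1 k = (k ! : ℂ) :=
  ascPochhammer_eval_one ℂ k

theorem poch_ne_zero {x : ℂ} (hx : 0 < x.re) (k : ℕ) : poch x k ≠ 0 := by
  induction k with
  | zero => simp [poch]
  | succ k ih =>
    rw [poch_succ]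
    refine mul_ne_zero ih fun h => ?_
    have h' := congrArg Complex.re h
    simp only [Complex.add_re, Complex.natCast_re, Complex.zero_re] at h'
    linarith [Nat.cast_nonneg (α := ℝ) k]

theorem poch_add_one_mul (x : ℂ) (k : ℕ) : poch (x + 1) k * x = poch x k * (x + k) := by
  induction k with
  | zero => simp [poch]
  | succ k ih =>
    rw [poch_succ, poch_succ]
    push_cast
    linear_combination (x + 1 + k) * ih

/-- The general term `k! / (2k+1)‼` of Euler's series for `π / 2`. -/
noncomputable def eulerTerm (k : ℕ) : ℝ :=
  (∏ i ∈ Finset.range k, (2 * (i : ℝ) + 2) / (2 * i + 3)) / 2 ^ k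

theorem eulerTerm_zero : eulerTerm 0 = 1 := by simp [eulerTerm]

theorem eulerTerm_succ (k : ℕ) :
    eulerTerm (k + 1) = eulerTerm k * ((k + 1) / (2 * k + 3)) := by
  simp only [eulerTerm, Finset.prod_range_succ]
  field_simp
  ring

theorem integral_sin_mul_pow (k : ℕ) :
    ∫ x in (0 : ℝ)..Real.pi, Real.sin x / 2 * (Real.sin x ^ 2 / 2) ^ k = eulerTerm k := by
  have h : ∀ x : ℝ, Real.sin x / 2 * (Real.sin x ^ 2 / 2) ^ k =
      (1 / 2 / 2 ^ k) * Real.sin x ^ (2 * k + 1) := fun x => by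
    rw [div_pow, ← pow_mul, pow_succ]
    ring
  simp only [h, intervalIntegral.integral_const_mul, integral_sin_pow_odd, eulerTerm]
  ring

theorem integral_sin_div_one_add_cos_sq :
    ∫ x in (0 : ℝ)..Real.pi, Real.sin x / (1 + Real.cos x ^ 2) = Real.pi / 2 := by
  have hderiv : ∀ x ∈ Set.uIcc (0 : ℝ) Real.pi,
      HasDerivAt (fun x => -Real.arctan (Real.cos x)) (Real.sin x / (1 + Real.cos x ^ 2)) x := by
    intro x _
    exact (Real.hasDerivAt_cos x).arctan.neg.congr_deriv (by ring)
  have hcont : Continuous fun x : ℝ => Real.sin x / (1 + Real.cos x ^ 2) :=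
    Real.continuous_sin.div (by fun_prop) fun x => by positivity
  rw [intervalIntegral.integral_eq_sub_of_hasDerivAt hderiv (hcont.intervalIntegrable _ _)]
  simp only [Real.cos_pi, Real.cos_zero, Real.arctan_neg, Real.arctan_one]
  ring

theorem hasSum_eulerTerm : HasSum eulerTerm (Real.pi / 2) := by
  rw [← integral_sin_div_one_add_cos_sq]
  simp only [← funext integral_sin_mul_pow]
  refine intervalIntegral.hasSum_integral_of_dominated_convergence
    (fun k _ => (1 / 2 : ℝ) ^ k) (fun k => ?_) (fun k => ?_) ?_ ?_ ?_
  · exact Continuous.aestronglyMeasurable (by fun_prop)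
  · refine .of_forall fun x _ => ?_
    rw [norm_mul, norm_pow, Real.norm_eq_abs, Real.norm_eq_abs,
      abs_of_nonneg (by positivity : 0 ≤ Real.sin x ^ 2 / 2), ← one_mul ((1 / 2 : ℝ) ^ k)]
    gcongr
    · rw [abs_le]
      constructor <;> linarith [Real.neg_one_le_sin x, Real.sin_le_one x]
    · exact Real.sin_sq_le_one x
  · exact .of_forall fun x _ => summable_geometric_two
  · exact intervalIntegrable_const
  · refine .of_forall fun x _ => ?_
    have hlt : Real.sin x ^ 2 / 2 < 1 := by linarith [Real.sin_sq_le_one x]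
    have hlim : Real.sin x / (1 + Real.cos x ^ 2) =
        Real.sin x / 2 * (1 - Real.sin x ^ 2 / 2)⁻¹ := by
      rw [Real.sin_sq, ← div_eq_mul_inv, div_div]
      ring_nf
    rw [hlim]
    exact (hasSum_geometric_of_lt_one (by positivity) hlt).mul_left (Real.sin x / 2)

theorem factorial_div_poch_five_halves (k : ℕ) :
    (k ! : ℂ) / poch (5 / 2) k * (1 / 2) ^ k = 3 * (eulerTerm k : ℂ) / (2 * k + 3) := by
  induction k with
  | zero => simp [poch, eulerTerm_zero]
  | succ k ih =>
    have h₃ : (2 * k + 3 : ℂ) ≠ 0 := by exact_mod_cast (by positivity : (2 * k + 3 : ℕ) ≠ 0)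
    have h₅ : (2 * k + 5 : ℂ) ≠ 0 := by exact_mod_cast (by positivity : (2 * k + 5 : ℕ) ≠ 0)
    have hp : poch (5 / 2) k ≠ 0 := poch_ne_zero (by norm_num) k
    have hstep : ((k + 1)! : ℂ) / poch (5 / 2) (k + 1) * (1 / 2) ^ (k + 1) =
        (k ! : ℂ) / poch (5 / 2) k * (1 / 2) ^ k * ((k + 1) / (2 * k + 5)) := by
      have h₅' : (5 / 2 + k : ℂ) = (2 * k + 5) / 2 := by ring
      rw [poch_succ, Nat.factorial_succ, h₅', pow_succ]
      push_cast
      field_simp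
    have h₅'' : (2 * ((k + 1 : ℕ) : ℂ) + 3) = 2 * k + 5 := by push_cast; ring
    rw [hstep, ih, eulerTerm_succ, h₅'']
    push_cast
    field_simp

theorem gauss_second_m0_n0 (d : ℂ) (hd : 0 < d.re) :
    hyp [1, 1, d + 1] [5/2, d] (1/2) =
      3 * (Real.pi : ℂ) * (1 / d - 1/2) - 3 * (3 / d - 2) := by
  have hd₀ : d ≠ 0 := by
    rintro rfl
    simp at hd
  have hu : HasSum (fun k => (eulerTerm k : ℂ)) ((Real.pi / 2 : ℝ) : ℂ) :=
    Complex.hasSum_ofReal.mpr hasSum_eulerTerm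
  have hu₁ : HasSum (fun k => (eulerTerm (k + 1) : ℂ)) (((Real.pi / 2 : ℝ) : ℂ) - 1) := by
    simpa [eulerTerm_zero] using (hasSum_nat_add_iff' 1).mpr hu
  have hsum := (hu.mul_left (3 - 3 / d)).add (hu₁.mul_left (9 / d - 6))
  rw [hyp]
  convert hsum.tsum_eq using 1
  · refine tsum_congr fun k => ?_
    have h₃ : (2 * k + 3 : ℂ) ≠ 0 := by exact_mod_cast (by positivity : (2 * k + 3 : ℕ) ≠ 0)
    have hf : (k ! : ℂ) ≠ 0 := by exact_mod_cast k.factorial_ne_zero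
    have hp : poch d k ≠ 0 := poch_ne_zero hd k
    have hq : poch (5 / 2) k ≠ 0 := poch_ne_zero (by norm_num) k
    have hratio : poch (d + 1) k = poch d k * (d + k) / d :=
      eq_div_of_mul_eq hd₀ (poch_add_one_mul d k)
    have hterm : (k ! : ℂ) * (k ! * poch (d + 1) k) / (poch (5 / 2) k * poch d k) *
        (1 / 2) ^ k / k ! = (k ! : ℂ) / poch (5 / 2) k * (1 / 2) ^ k * ((d + k) / d) := by
      rw [hratio]
      field_simp
    simp only [List.map_cons, List.map_nil, List.prod_cons, List.prod_nil, mul_one, poch_one]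
    rw [hterm, factorial_div_poch_five_halves, eulerTerm_succ]
    push_cast
    field_simp
    ring
  · push_cast
    field_simp
    ring
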